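/- arXiv:2308.15782 — 2 statements merged into one kernel-verified Lean document; each statement's English description precedes it below -/
import Mathlib

section
/- Let z ∈ (0,1/2) and q ∈ (0,1]. Then Σ_{m1≥0} Σ_{m2≥0} g_{m1,m2}(q)·z^{m1+m2} = 1/(1−2z) + (q−1)·(q·z² + (1−q+q·z)·P(z²)) / (z·(1−2z)·(1 − 2q·P(z²))). -/
/-- The polynomials `g_{m1,m2}(q)` defined by the recurrence
`g_{m1,m2}(q) = q^{δ(c,m1)} g_{m1-1,m2}(q) + g_{m1,m2-1}(q)` with `c = ⌊(m1+m2)/2⌋+1`,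
`g_{0,0} = 1` and `g` vanishing for negative indices. -/
noncomputable def gP : ℕ → ℕ → Polynomial ℝ
  | 0, 0 => 1
  | 0, m2 + 1 => gP 0 m2
  | m1 + 1, 0 =>
      Polynomial.X ^ (if (m1 + 1) / 2 + 1 = m1 + 1 then 1 else 0) * gP m1 0
  | m1 + 1, m2 + 1 =>
      Polynomial.X ^ (if (m1 + 1 + (m2 + 1)) / 2 + 1 = m1 + 1 then 1 else 0) * gP m1 (m2 + 1)
        + gP (m1 + 1) m2

/-- `P(t) = (1 - √(1-4t))/2`, the generating function of shifted Catalan numbers. -/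
noncomputable def Pgf (t : ℝ) : ℝ := (1 - Real.sqrt (1 - 4 * t)) / 2

open Finset in
/-- Summation by parts for `gP` along consecutive antidiagonals. -/
theorem sum_antidiagonal_succ_gP_mul (q : ℝ) (F : ℕ → ℕ → ℝ) (n : ℕ) :
    ∑ p ∈ antidiagonal (n + 1), (gP p.1 p.2).eval q * F p.1 p.2 =
      ∑ p ∈ antidiagonal n, (gP p.1 p.2).eval q *
        (q ^ (if (p.1 + 1 + p.2) / 2 + 1 = p.1 + 1 then 1 else 0) * F (p.1 + 1) p.2
          + F p.1 (p.2 + 1)) := by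
  let A : ℕ → ℕ → ℝ
    | 0, _ => 0
    | i + 1, j => (gP i j).eval q *
        (q ^ (if (i + 1 + j) / 2 + 1 = i + 1 then 1 else 0) * F (i + 1) j)
  let B : ℕ → ℕ → ℝ
    | _, 0 => 0
    | i, j + 1 => (gP i j).eval q * F i (j + 1)
  have key : ∀ p ∈ antidiagonal (n + 1),
      (gP p.1 p.2).eval q * F p.1 p.2 = A p.1 p.2 + B p.1 p.2 := by
    rintro ⟨i, j⟩ hp
    rw [HasAntidiagonal.mem_antidiagonal] at hp
    rcases i with _ | i <;> rcases j with _ | j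
    · simp at hp
    · simp [A, B, gP]
    · simp only [A, B, gP, Polynomial.eval_mul, Polynomial.eval_pow, Polynomial.eval_X, add_zero]
      ring
    · simp only [A, B, gP, Polynomial.eval_mul, Polynomial.eval_pow, Polynomial.eval_X,
        Polynomial.eval_add]
      ring
  rw [sum_congr rfl key, sum_add_distrib,
    Nat.sum_antidiagonal_succ (f := fun p => A p.1 p.2),
    Nat.sum_antidiagonal_succ' (f := fun p => B p.1 p.2)]
  simp only [A, B, zero_add, mul_add, sum_add_distrib]

theorem gP_eval_nonneg {q : ℝ} (hq : 0 ≤ q) (i j : ℕ) : 0 ≤ (gP i j).eval q := by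
  fun_induction gP i j with
  | case1 => simp
  | case2 _ ih => exact ih
  | case3 _ ih =>
    rw [Polynomial.eval_mul, Polynomial.eval_pow, Polynomial.eval_X]
    exact mul_nonneg (pow_nonneg hq _) ih
  | case4 _ _ ih₁ ih₂ =>
    rw [Polynomial.eval_add, Polynomial.eval_mul, Polynomial.eval_pow, Polynomial.eval_X]
    exact add_nonneg (mul_nonneg (pow_nonneg hq _) ih₁) ih₂

open Finset in
theorem sum_antidiagonal_gP_le {q : ℝ} (hq0 : 0 ≤ q) (hq1 : q ≤ 1) (n : ℕ) :
    ∑ p ∈ antidiagonal n, (gP p.1 p.2).eval q ≤ 2 ^ n := by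
  induction n with
  | zero => simp [gP]
  | succ n ih =>
    have h := sum_antidiagonal_succ_gP_mul q (fun _ _ => 1) n
    simp only [mul_one] at h
    rw [h, pow_succ]
    refine le_trans ?_ (mul_le_mul_of_nonneg_right ih zero_le_two)
    rw [sum_mul]
    refine sum_le_sum fun p _ => mul_le_mul_of_nonneg_left ?_ (gP_eval_nonneg hq0 _ _)
    linarith [pow_le_one₀ (n := if (p.1 + 1 + p.2) / 2 + 1 = p.1 + 1 then 1 else 0) hq0 hq1]

open Finset in
/-- A bounded solution of the backward equation computes the generating function of `gP`. -/
theorem hasSum_gP_of_backward_equation {z q C : ℝ} (hz0 : 0 ≤ z) (hz1 : z < 1 / 2)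
    (hq0 : 0 ≤ q) (hq1 : q ≤ 1) (h : ℕ → ℕ → ℝ) (hC : ∀ i j, |h i j| ≤ C)
    (heq : ∀ i j, h i j = 1 + z * (q ^ (if (i + 1 + j) / 2 + 1 = i + 1 then 1 else 0) *
      h (i + 1) j + h i (j + 1))) :
    HasSum (fun p : ℕ × ℕ => (gP p.1 p.2).eval q * z ^ (p.1 + p.2)) (h 0 0) := by
  set S : ℕ → ℝ := fun n => z ^ n * ∑ p ∈ antidiagonal n, (gP p.1 p.2).eval q with hS
  set R : ℕ → ℝ := fun n => z ^ n * ∑ p ∈ antidiagonal n, (gP p.1 p.2).eval q * h p.1 p.2 with hR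
  have hstep (n : ℕ) : R n = S n + R (n + 1) := by
    simp only [hR, hS]
    rw [sum_antidiagonal_succ_gP_mul, pow_succ, mul_assoc, ← mul_add, mul_sum _ _ z, ← sum_add_distrib]
    congr 1
    refine sum_congr rfl fun p _ => ?_
    conv_lhs => rw [heq p.1 p.2]
    ring
  have hpartial (n : ℕ) : ∑ k ∈ range n, S k = h 0 0 - R n := by
    induction n with
    | zero => simp [hR, gP]
    | succ n ih => rw [sum_range_succ, ih, hstep n]; ring
  have hRbound (n : ℕ) : ‖R n‖ ≤ C * (2 * z) ^ n := by
    have hsum : |∑ p ∈ antidiagonal n, (gP p.1 p.2).eval q * h p.1 p.2| ≤ 2 ^ n * C := by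
      refine (abs_sum_le_sum_abs _ _).trans ?_
      refine le_trans ?_ (mul_le_mul_of_nonneg_right (sum_antidiagonal_gP_le hq0 hq1 n)
        ((abs_nonneg _).trans (hC 0 0)))
      rw [sum_mul]
      refine sum_le_sum fun p _ => ?_
      rw [abs_mul, abs_of_nonneg (gP_eval_nonneg hq0 _ _)]
      exact mul_le_mul_of_nonneg_left (hC _ _) (gP_eval_nonneg hq0 _ _)
    rw [Real.norm_eq_abs, abs_mul, abs_of_nonneg (pow_nonneg hz0 n)]
    refine (mul_le_mul_of_nonneg_left hsum (pow_nonneg hz0 n)).trans_eq ?_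
    rw [mul_pow]; ring
  have hR0 : Filter.Tendsto R Filter.atTop (nhds 0) := by
    refine squeeze_zero_norm hRbound ?_
    simpa using (tendsto_pow_atTop_nhds_zero_of_lt_one (by linarith : 0 ≤ 2 * z)
      (by linarith)).const_mul C
  have hSsum : HasSum S (h 0 0) := by
    rw [hasSum_iff_tendsto_nat_of_nonneg fun n =>
      mul_nonneg (pow_nonneg hz0 n) (sum_nonneg fun p _ => gP_eval_nonneg hq0 _ _)]
    rw [funext hpartial]
    simpa using hR0.const_sub (h 0 0)
  rw [← HasAntidiagonal.sigmaAntidiagonalEquivProd.hasSum_iff]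
  have hfiber (n : ℕ) : HasSum (fun c : antidiagonal n =>
      (gP c.1.1 c.1.2).eval q * z ^ (c.1.1 + c.1.2)) (S n) := by
    have hn : S n = ∑ p ∈ antidiagonal n, (gP p.1 p.2).eval q * z ^ (p.1 + p.2) := by
      simp only [hS, mul_sum]
      refine sum_congr rfl fun p hp => ?_
      rw [HasAntidiagonal.mem_antidiagonal.mp hp, mul_comm]
    rw [hn]
    exact Finset.hasSum _ fun p : ℕ × ℕ => (gP p.1 p.2).eval q * z ^ (p.1 + p.2)
  have hsummable : Summable ((fun p : ℕ × ℕ => (gP p.1 p.2).eval q * z ^ (p.1 + p.2)) ∘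
      HasAntidiagonal.sigmaAntidiagonalEquivProd) := by
    refine (summable_sigma_of_nonneg fun x =>
      mul_nonneg (gP_eval_nonneg hq0 _ _) (pow_nonneg hz0 _)).mpr ⟨fun n => (hfiber n).summable, ?_⟩
    convert hSsum.summable using 2 with n
    exact (hfiber n).tsum_eq
  exact (hsummable.hasSum.sigma hfiber).unique hSsum ▸ hsummable.hasSum

/-- The candidate solution of the backward equation, as a function of the height `m1 - m2`. -/
noncomputable def backwardSolution (T A B u : ℝ) (d : ℤ) : ℝ :=
  if 1 ≤ d then T + A * u ^ (d - 1).toNat else T + B * u ^ (-d).toNat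

theorem backwardSolution_of_pos (T A B u : ℝ) (n : ℕ) :
    backwardSolution T A B u (n + 1) = T + A * u ^ n := by
  rw [backwardSolution, if_pos (by lia)]
  simp

theorem backwardSolution_of_nonpos (T A B u : ℝ) (n : ℕ) :
    backwardSolution T A B u (-n) = T + B * u ^ n := by
  rw [backwardSolution, if_neg (by lia)]
  simp

theorem abs_backwardSolution_le (T A B : ℝ) {u : ℝ} (hu0 : 0 ≤ u) (hu1 : u ≤ 1) (d : ℤ) :
    |backwardSolution T A B u d| ≤ |T| + |A| + |B| := by
  have bound (D : ℝ) (n : ℕ) : |T + D * u ^ n| ≤ |T| + |D| := by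
    refine (abs_add_le _ _).trans (add_le_add_right ?_ _)
    rw [abs_mul, abs_of_nonneg (pow_nonneg hu0 n)]
    exact mul_le_of_le_one_right (abs_nonneg _) (pow_le_one₀ hu0 hu1)
  rw [backwardSolution]
  split_ifs
  · linarith [bound A (d - 1).toNat, abs_nonneg B]
  · linarith [bound B (-d).toNat, abs_nonneg A]

theorem backwardSolution_eq {z q T A B u : ℝ} (hT : T = 1 + 2 * z * T)
    (hu : u = z * (1 + u ^ 2)) (h0 : T + B = 1 + z * (q * (T + A) + (T + B * u)))
    (h1 : T + A = 1 + z * (q * (T + A * u) + (T + B))) (d : ℤ) :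
    backwardSolution T A B u d = 1 + z * (q ^ (if d = 0 ∨ d = 1 then 1 else 0) *
      backwardSolution T A B u (d + 1) + backwardSolution T A B u (d - 1)) := by
  have hpos := backwardSolution_of_pos T A B u
  have hneg := backwardSolution_of_nonpos T A B u
  have e0 : backwardSolution T A B u 0 = T + B := by simpa using hneg 0
  have e1 : backwardSolution T A B u 1 = T + A := by simpa using hpos 0
  rcases lt_or_ge 1 d with hd | hd
  · obtain ⟨n, rfl⟩ : ∃ n : ℕ, d = n + 2 := ⟨(d - 2).toNat, by lia⟩
    rw [if_neg (by lia), show (n : ℤ) + 2 = (n + 1 : ℕ) + 1 by push_cast; ring, hpos,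
      show ((n + 1 : ℕ) : ℤ) + 1 + 1 = (n + 2 : ℕ) + 1 by push_cast; ring, hpos,
      show ((n + 1 : ℕ) : ℤ) + 1 - 1 = n + 1 by push_cast; ring, hpos]
    linear_combination hT + A * u ^ n * hu
  rcases lt_or_ge d 0 with hd' | hd'
  · obtain ⟨n, rfl⟩ : ∃ n : ℕ, d = -((n + 1 : ℕ) : ℤ) := ⟨(-d - 1).toNat, by lia⟩
    rw [if_neg (by lia), hneg, show -((n + 1 : ℕ) : ℤ) + 1 = -(n : ℤ) by push_cast; ring, hneg,
      show -((n + 1 : ℕ) : ℤ) - 1 = -((n + 2 : ℕ) : ℤ) by push_cast; ring, hneg]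
    linear_combination hT + B * u ^ n * hu
  obtain rfl | rfl : d = 0 ∨ d = 1 := by lia
  · have e : backwardSolution T A B u (-1) = T + B * u := by simpa using hneg 1
    simpa [e0, e1, e] using h0
  · have e : backwardSolution T A B u (1 + 1) = T + A * u := by simpa using hpos 1
    rw [e]; simpa [e0, e1] using h1

theorem Pgf_eq {t : ℝ} (ht : t ≤ 1 / 4) : Pgf t = t + Pgf t ^ 2 := by
  have := Real.sq_sqrt (show 0 ≤ 1 - 4 * t by linarith)
  rw [Pgf]
  linear_combination (1 / 4 : ℝ) * -this

theorem stmt1 (z q : ℝ) (hz : z ∈ Set.Ioo (0 : ℝ) (1 / 2)) (hq : q ∈ Set.Ioc (0 : ℝ) 1) :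
    Summable (fun p : ℕ × ℕ => (gP p.1 p.2).eval q * z ^ (p.1 + p.2)) ∧
    ∑' p : ℕ × ℕ, (gP p.1 p.2).eval q * z ^ (p.1 + p.2)
      = 1 / (1 - 2 * z)
        + (q - 1) * (q * z ^ 2 + (1 - q + q * z) * Pgf (z ^ 2))
          / (z * (1 - 2 * z) * (1 - 2 * q * Pgf (z ^ 2))) := by
  obtain ⟨hz0, hz1⟩ := hz
  obtain ⟨hq0, hq1⟩ := hq
  have hz2 : z ^ 2 < 1 / 4 := by nlinarith
  have hP := Pgf_eq hz2.le
  have hs : 0 < √(1 - 4 * z ^ 2) := Real.sqrt_pos.mpr (by linarith)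
  have hP2 : 2 * Pgf (z ^ 2) < 1 := by rw [Pgf]; linarith
  have hP0 : 0 ≤ Pgf (z ^ 2) := by rw [hP]; positivity
  obtain ⟨u, hu⟩ : ∃ u, Pgf (z ^ 2) = z * u := ⟨Pgf (z ^ 2) / z, by field_simp⟩
  rw [hu] at hP hP2 hP0 ⊢
  have hu0 : 0 ≤ u := nonneg_of_mul_nonneg_right hP0 hz0
  have hueq : u = z * (1 + u ^ 2) := mul_left_cancel₀ hz0.ne' (by linear_combination hP)
  have hu1 : u ≤ 1 := by nlinarith
  have hD : 1 - 2 * q * (z * u) ≠ 0 := by nlinarith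
  have hz' : 1 - 2 * z ≠ 0 := by linarith
  set T : ℝ := 1 / (1 - 2 * z) with hTdef
  set E : ℝ := 1 / (1 - 2 * q * (z * u)) with hEdef
  have hT : T = 1 + 2 * z * T := by rw [hTdef]; field_simp; ring
  have hE : E = 1 + 2 * q * (z * u) * E := by linear_combination one_div_mul_cancel hD
  set A : ℝ := (q - 1) * z * T * (1 + u) * E with hA
  set B : ℝ := u * (q * A + (q - 1) * T) with hB
  have h1 : T + A = 1 + z * (q * (T + A * u) + (T + B)) := by
    rw [hB, hA]
    linear_combination hT + (q - 1) * z * T * (1 + u) * hE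
  have h0 : T + B = 1 + z * (q * (T + A) + (T + B * u)) := by
    rw [hB]
    linear_combination hT + (q * A + (q - 1) * T) * hueq
  have hsum := hasSum_gP_of_backward_equation hz0.le hz1 hq0.le hq1
    (fun i j => backwardSolution T A B u ((i : ℤ) - j))
    (fun i j => abs_backwardSolution_le T A B hu0 hu1 _) (fun i j => by
      have hiff : (i + 1 + j) / 2 + 1 = i + 1 ↔ (i : ℤ) - j = 0 ∨ (i : ℤ) - j = 1 := by lia
      simp only [hiff, Nat.cast_add, Nat.cast_one, add_sub_right_comm, ← sub_sub]
      exact backwardSolution_eq hT hueq h0 h1 ((i : ℤ) - j))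
  refine ⟨hsum.summable, hsum.tsum_eq.trans ?_⟩
  have hvalue : backwardSolution T A B u ((0 : ℕ) - (0 : ℕ)) = T + B := by
    simpa using backwardSolution_of_nonpos T A B u 0
  have hrhs : (q - 1) * (q * z ^ 2 + (1 - q + q * z) * (z * u)) /
      (z * (1 - 2 * z) * (1 - 2 * q * (z * u))) =
      (q - 1) * (q * z + (1 - q + q * z) * u) * T * E := by
    rw [hTdef, hEdef]
    field_simp
  rw [hvalue, hrhs, hB, hA]
  linear_combination -(q - 1) * u * T * hE + (q - 1) * q * T * E * hueq
end

section
/- Let z ∈ (0,1/2) and q ∈ (0,1]. Then Σ_{m≥0} g_{m+1,m}(q)·z^{2m+1} = q·P(z²) / (z·(1 − 2q·P(z²))). -/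
/-- The weight of an up-step ending at height `d`: the steps `0 → 1` and `1 → 2` carry `q`. -/
noncomputable def stepWeight (q : ℝ) (d : ℤ) : ℝ := if d = 1 ∨ d = 2 then q else 1

/-- The weighted number of `±1`-walks of length `n` from height `0` to height `d`. -/
noncomputable def walkCount (q : ℝ) : ℕ → ℤ → ℝ
  | 0, d => if d = 0 then 1 else 0
  | n + 1, d => stepWeight q d * walkCount q n (d - 1) + walkCount q n (d + 1)

theorem walkCount_nonneg {q : ℝ} (hq : 0 ≤ q) (n : ℕ) (d : ℤ) : 0 ≤ walkCount q n d := by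
  induction n generalizing d with
  | zero => unfold walkCount; split_ifs <;> simp
  | succ n ih =>
    have hw : 0 ≤ stepWeight q d := by unfold stepWeight; split_ifs <;> simp [hq]
    exact add_nonneg (mul_nonneg hw (ih _)) (ih _)

theorem walkCount_eq_zero_of_lt (q : ℝ) (n : ℕ) (d : ℤ) (h : n < d.natAbs) :
    walkCount q n d = 0 := by
  induction n generalizing d with
  | zero => exact if_neg (by omega)
  | succ n ih => rw [walkCount, ih _ (by omega), ih _ (by omega)]; simp

theorem walkCount_eq_zero_of_odd (q : ℝ) (n : ℕ) (d : ℤ) (h : (n + d) % 2 = 1) :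
    walkCount q n d = 0 := by
  induction n generalizing d with
  | zero => exact if_neg (by omega)
  | succ n ih => rw [walkCount, ih _ (by omega), ih _ (by omega)]; simp

theorem eval_gP_eq_walkCount (q : ℝ) (m₁ m₂ : ℕ) :
    (gP m₁ m₂).eval q = walkCount q (m₁ + m₂) (m₁ - m₂) := by
  fun_induction gP m₁ m₂ with
  | case1 => simp [walkCount]
  | case2 m₂ ih =>
    rw [ih, Nat.succ_eq_add_one, ← add_assoc, walkCount,
      walkCount_eq_zero_of_lt q (0 + m₂) (_ - 1) (by omega), mul_zero, zero_add]
    push_cast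
    ring_nf
  | case3 m₁ ih =>
    rw [Polynomial.eval_mul, ih, add_zero, add_zero, walkCount,
      walkCount_eq_zero_of_lt q m₁ (_ + 1) (by omega), add_zero]
    congr 1
    · unfold stepWeight
      split_ifs <;> first | omega | simp
    · congr 1
      push_cast
      ring
  | case4 m₁ m₂ ih₁ ih₂ =>
    rw [Polynomial.eval_add, Polynomial.eval_mul, ih₁, ih₂, ← add_assoc (m₁ + 1), walkCount]
    congr 1
    · congr 1
      · unfold stepWeight
        split_ifs <;> first | omega | simp
      · congr 1
        · omega
        · push_cast
          ring
    · congr 1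
      push_cast
      ring

/-- A bounded solution of the first-step equations is the generating function of the walks. -/
theorem hasSum_walkCount {q z M : ℝ} (hq : q ∈ Set.Ioc (0 : ℝ) 1)
    (hz : z ∈ Set.Ioo (0 : ℝ) (1 / 2))
    (F : ℤ → ℝ) (hM : ∀ d, |F d| ≤ M)
    (hF : ∀ d, F d = (if d = 0 then 1 else 0) + z * (stepWeight q d * F (d - 1) + F (d + 1)))
    (d : ℤ) : HasSum (fun n => walkCount q n d * z ^ n) (F d) := by
  obtain ⟨hz0, hz1⟩ := hz
  have hrem : ∀ (N : ℕ) (d : ℤ),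
      |F d - ∑ n ∈ Finset.range N, walkCount q n d * z ^ n| ≤ (2 * z) ^ N * M := by
    intro N
    induction N with
    | zero => simpa using hM
    | succ N ih =>
      intro d
      have hw0 : 0 ≤ stepWeight q d := by unfold stepWeight; split_ifs <;> simp [hq.1.le]
      have hw1 : stepWeight q d ≤ 1 := by unfold stepWeight; split_ifs <;> simp [hq.2]
      have hsum : ∑ n ∈ Finset.range (N + 1), walkCount q n d * z ^ n
          = (if d = 0 then 1 else 0)
            + z * (stepWeight q d * ∑ n ∈ Finset.range N, walkCount q n (d - 1) * z ^ n
              + ∑ n ∈ Finset.range N, walkCount q n (d + 1) * z ^ n) := by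
        rw [Finset.sum_range_succ', add_comm, Finset.mul_sum, ← Finset.sum_add_distrib,
          Finset.mul_sum]
        congr 1
        · simp [walkCount]
        · refine Finset.sum_congr rfl fun n _ => ?_
          rw [walkCount]
          ring
      have h₁ := ih (d - 1)
      have h₂ := ih (d + 1)
      rw [hsum, hF d]
      set S₁ := ∑ n ∈ Finset.range N, walkCount q n (d - 1) * z ^ n
      set S₂ := ∑ n ∈ Finset.range N, walkCount q n (d + 1) * z ^ n
      calc _ = z * |stepWeight q d * (F (d - 1) - S₁) + (F (d + 1) - S₂)| := by
            rw [← abs_of_pos hz0, ← abs_mul, abs_of_pos hz0]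
            congr 1
            ring
        _ ≤ z * (1 * ((2 * z) ^ N * M) + (2 * z) ^ N * M) := by
            gcongr
            refine (abs_add_le _ _).trans (add_le_add ?_ h₂)
            rw [abs_mul, abs_of_nonneg hw0]
            exact mul_le_mul hw1 h₁ (abs_nonneg _) zero_le_one
        _ = (2 * z) ^ (N + 1) * M := by ring
  rw [hasSum_iff_tendsto_nat_of_nonneg
    fun n => mul_nonneg (walkCount_nonneg hq.1.le n d) (pow_nonneg hz0.le n)]
  rw [tendsto_iff_dist_tendsto_zero]
  have hlim : Filter.Tendsto (fun N : ℕ => (2 * z) ^ N * M) Filter.atTop (nhds 0) := by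
    simpa using (tendsto_pow_atTop_nhds_zero_of_lt_one (by linarith : 0 ≤ 2 * z)
      (by linarith)).mul_const M
  refine squeeze_zero (fun _ => dist_nonneg) (fun N => ?_) hlim
  rw [dist_comm, Real.dist_eq]
  exact hrem N d

/-- The closed form of the generating function of walks ending at height `d`, where `r` is the
small root of `z * (1 + r ^ 2) = r`. -/
noncomputable def walkGF (q z r : ℝ) : ℤ → ℝ
  | .negSucc k => (1 - q * (z * r)) / ((1 - z * r) * (1 - 2 * q * (z * r))) * r ^ (k + 1)
  | .ofNat 0 => (1 - q * (z * r)) / ((1 - z * r) * (1 - 2 * q * (z * r)))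
  | .ofNat 1 => q * r / (1 - 2 * q * (z * r))
  | .ofNat (k + 2) => q * (q * r / (1 - 2 * q * (z * r))) * r ^ (k + 1)

theorem walkGF_bounded (q z : ℝ) {r : ℝ} (hr0 : 0 ≤ r) (hr1 : r ≤ 1) :
    ∃ M, ∀ d, |walkGF q z r d| ≤ M := by
  set A := (1 - q * (z * r)) / ((1 - z * r) * (1 - 2 * q * (z * r)))
  set B := q * r / (1 - 2 * q * (z * r))
  have hpow : ∀ (c : ℝ) (k : ℕ), |c * r ^ k| ≤ |c| := fun c k => by
    rw [abs_mul, abs_of_nonneg (pow_nonneg hr0 k)]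
    exact mul_le_of_le_one_right (abs_nonneg c) (pow_le_one₀ hr0 hr1)
  refine ⟨|A| + |B| + |q * B|, fun d => ?_⟩
  have h₁ := abs_nonneg A
  have h₂ := abs_nonneg B
  have h₃ := abs_nonneg (q * B)
  match d with
  | .negSucc k => exact (hpow A _).trans (by linarith)
  | .ofNat 0 => show |A| ≤ _; linarith
  | .ofNat 1 => show |B| ≤ _; linarith
  | .ofNat (k + 2) => exact (hpow (q * B) _).trans (by linarith)

theorem walkGF_eq {q z r : ℝ} (h : z * (1 + r ^ 2) = r) (h₁ : 1 - z * r ≠ 0)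
    (h₂ : 1 - 2 * q * (z * r) ≠ 0) (d : ℤ) :
    walkGF q z r d = (if d = 0 then 1 else 0)
      + z * (stepWeight q d * walkGF q z r (d - 1) + walkGF q z r (d + 1)) := by
  obtain ⟨E, hE⟩ : ∃ E, E = 1 - z * r := ⟨_, rfl⟩
  obtain ⟨D, hD⟩ : ∃ D, D = 1 - 2 * q * (z * r) := ⟨_, rfl⟩
  rw [← hE] at h₁
  rw [← hD] at h₂
  match d with
  | .negSucc 0 =>
    show walkGF q z r (.negSucc 0)
      = 0 + z * (1 * walkGF q z r (.negSucc 1) + walkGF q z r (.ofNat 0))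
    simp only [walkGF]
    linear_combination (-(1 - q * (z * r)) / ((1 - z * r) * (1 - 2 * q * (z * r)))) * h
  | .negSucc (k + 1) =>
    show walkGF q z r (.negSucc (k + 1))
      = 0 + z * (1 * walkGF q z r (.negSucc (k + 2)) + walkGF q z r (.negSucc k))
    simp only [walkGF]
    linear_combination
      (-(1 - q * (z * r)) / ((1 - z * r) * (1 - 2 * q * (z * r))) * r ^ (k + 1)) * h
  | .ofNat 0 =>
    show walkGF q z r (.ofNat 0)
      = 1 + z * (1 * walkGF q z r (.negSucc 0) + walkGF q z r (.ofNat 1))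
    simp only [walkGF, ← hD, ← hE]
    field_simp
    linear_combination (-(1 - q * (z * r))) * hE - E * hD
  | .ofNat 1 =>
    show walkGF q z r (.ofNat 1)
      = 0 + z * (q * walkGF q z r (.ofNat 0) + walkGF q z r (.ofNat 2))
    simp only [walkGF, ← hD, ← hE]
    field_simp
    linear_combination q * (1 - q * (z * r)) * (r * hE - h)
  | .ofNat 2 =>
    show walkGF q z r (.ofNat 2)
      = 0 + z * (q * walkGF q z r (.ofNat 1) + walkGF q z r (.ofNat 3))
    simp only [walkGF]
    linear_combination (-q * (q * r / (1 - 2 * q * (z * r)))) * h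
  | .ofNat (k + 3) =>
    have hw : stepWeight q (.ofNat (k + 3)) = 1 := if_neg (by simp; omega)
    have hd : (Int.ofNat (k + 3)) - 1 = .ofNat (k + 2) := by simp; omega
    rw [hw, hd, if_neg (by simp; omega)]
    show walkGF q z r (.ofNat (k + 3))
      = 0 + z * (1 * walkGF q z r (.ofNat (k + 2)) + walkGF q z r (.ofNat (k + 4)))
    simp only [walkGF]
    linear_combination (-q * (q * r / (1 - 2 * q * (z * r))) * r ^ (k + 1)) * h

theorem stmt3 (z q : ℝ) (hz : z ∈ Set.Ioo (0 : ℝ) (1 / 2)) (hq : q ∈ Set.Ioc (0 : ℝ) 1) :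
    Summable (fun m : ℕ => (gP (m + 1) m).eval q * z ^ (2 * m + 1)) ∧
    ∑' m : ℕ, (gP (m + 1) m).eval q * z ^ (2 * m + 1)
      = q * Pgf (z ^ 2) / (z * (1 - 2 * q * Pgf (z ^ 2))) := by
  obtain ⟨hz0, hz1⟩ := hz
  obtain ⟨hq0, hq1⟩ := hq
  set p := Pgf (z ^ 2) with hp
  have hdisc : 0 < 1 - 4 * z ^ 2 := by nlinarith
  have hsqrt := Real.sqrt_pos.2 hdisc
  have hsq := Real.sq_sqrt hdisc.le
  have hpz : p * (1 - p) = z ^ 2 := by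
    rw [hp, Pgf]
    linear_combination (-1 / 4) * hsq
  have hp_half : p < 1 / 2 := by
    rw [hp, Pgf]
    linarith
  have hp0 : 0 < p := by nlinarith
  have hpltz : p < z := by nlinarith
  have hzp : z * (p / z) = p := mul_div_cancel₀ p hz0.ne'
  have hden : 1 - 2 * q * p ≠ 0 := by nlinarith
  have hroot : z * (1 + (p / z) ^ 2) = p / z := by
    field_simp
    linear_combination -hpz
  obtain ⟨M, hM⟩ := walkGF_bounded q z (div_pos hp0 hz0).le ((div_le_one hz0).2 hpltz.le)
  have hF := walkGF_eq (q := q) hroot (by rw [hzp]; linarith) (by rwa [hzp])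
  have hsum := hasSum_walkCount ⟨hq0, hq1⟩ ⟨hz0, hz1⟩ _ hM hF 1
  have hinj : Function.Injective fun m : ℕ => 2 * m + 1 := fun a b hab => by
    simpa using hab
  rw [← hinj.hasSum_iff] at hsum
  · have hval : walkGF q z (p / z) 1 = q * p / (z * (1 - 2 * q * p)) := by
      show q * (p / z) / (1 - 2 * q * (z * (p / z))) = _
      rw [hzp, ← mul_div_assoc, div_div]
    have hterm : ∀ m : ℕ, (gP (m + 1) m).eval q = walkCount q (2 * m + 1) 1 := fun m => by
      rw [eval_gP_eq_walkCount]
      congr 1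
      · ring
      · push_cast
        ring
    simp only [hterm]
    rw [hval] at hsum
    exact ⟨hsum.summable, hsum.tsum_eq⟩
  · intro n hn
    have hpar : ((n : ℤ) + 1) % 2 = 1 := by
      by_contra hodd
      exact hn ⟨n / 2, by show 2 * (n / 2) + 1 = n; omega⟩
    simp [walkCount_eq_zero_of_odd q n 1 hpar]
end
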